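/- The double integral ∫_{-1}^{1} ∫_{-1}^{1} log|s-t| (1-t²)^{-1/2} T_l(t) (1-s²)^{-1/2} T_n(s) dt ds equals -π² log 2 if l = n = 0, equals -π²/(2n) if l = n ≠ 0, and equals 0 if l ≠ n. -/

import Mathlib

namespace LogCheb

open Real MeasureTheory intervalIntegral

lemma ii_log (a b c : ℝ) :
    IntervalIntegrable (fun x => log (sin (x / 2 + c))) volume a b := by
  have h : AnalyticOnNhd ℝ (fun x : ℝ => sin (x / 2 + c)) Set.univ := by
    intro x _
    fun_prop
  have := (h.meromorphicOn.mono_set (Set.subset_univ (Set.uIcc a b))).intervalIntegrable_log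
  simpa [Function.comp_def] using this

lemma sin_even (l : ℕ) (v : ℝ) :
    sin (2 * l * v) = sin v * ∑ k ∈ Finset.range l, 2 * cos ((2 * k + 1) * v) := by
  induction l with
  | zero => simp
  | succ l ih =>
    rw [Finset.sum_range_succ, mul_add, ← ih]
    push_cast
    have h1 : 2 * ((l:ℝ) + 1) * v = (2 * l + 1) * v + v := by ring
    have h2 : 2 * (l:ℝ) * v = (2 * l + 1) * v - v := by ring
    rw [h1, h2, sin_add, sin_sub]
    ring

lemma int_cos (k : ℕ) (hk : k ≠ 0) : ∫ v in (0:ℝ)..π, cos (k * v) = 0 := by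
  have hk' : (k:ℝ) ≠ 0 := by exact_mod_cast hk
  rw [intervalIntegral.integral_comp_mul_left _ hk', integral_cos]
  simp

lemma int_dir (l : ℕ) (hl : l ≠ 0) :
    ∫ v in (0:ℝ)..π, cos v * ∑ k ∈ Finset.range l, 2 * cos ((2 * k + 1) * v) = π := by
  have h : ∀ v : ℝ, cos v * ∑ k ∈ Finset.range l, 2 * cos ((2 * k + 1) * v)
      = ∑ k ∈ Finset.range l, (cos (((2 * k + 2 : ℕ) : ℝ) * v) + cos (((2 * k : ℕ) : ℝ) * v)) := by
    intro v
    rw [Finset.mul_sum]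
    refine Finset.sum_congr rfl fun k _ => ?_
    push_cast
    have h1 : (2 * (k:ℝ) + 2) * v = (2 * k + 1) * v + v := by ring
    have h2 : 2 * (k:ℝ) * v = (2 * k + 1) * v - v := by ring
    rw [h1, h2, cos_add, cos_sub]
    ring
  simp_rw [h]
  rw [intervalIntegral.integral_finsetSum
    (fun k _ => Continuous.intervalIntegrable (by fun_prop) _ _)]
  have h2 : ∀ k ∈ Finset.range l, (∫ v in (0:ℝ)..π,
      (cos (((2 * k + 2 : ℕ) : ℝ) * v) + cos (((2 * k : ℕ) : ℝ) * v))) = if k = 0 then π else 0 := by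
    intro k _
    rw [intervalIntegral.integral_add (Continuous.intervalIntegrable (by fun_prop) _ _)
      (Continuous.intervalIntegrable (by fun_prop) _ _), int_cos _ (by omega)]
    split_ifs with hk
    · subst hk; simp
    · rw [int_cos _ (by omega)]; simp
  rw [Finset.sum_congr rfl h2]
  simp [hl, Nat.pos_of_ne_zero hl]

lemma int_log_sin_cos (l : ℕ) (hl : l ≠ 0) :
    ∫ v in (0:ℝ)..π, log (sin v) * cos (2 * l * v) = -π / (2 * l) := by
  have hl' : (l:ℝ) ≠ 0 := by exact_mod_cast hl
  set q : ℝ → ℝ := fun v => ∑ k ∈ Finset.range l, 2 * cos ((2 * k + 1) * v) with hq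
  have hqc : Continuous q := by fun_prop
  have hF : ∀ v : ℝ, log (sin v) * sin (2 * l * v) = (sin v * log (sin v)) * q v := by
    intro v; rw [sin_even]; ring
  have hi1 : IntervalIntegrable (fun v => 2 * l * (log (sin v) * cos (2 * l * v))) volume 0 π := by
    apply IntervalIntegrable.const_mul
    apply IntervalIntegrable.mul_continuousOn (by exact intervalIntegrable_log_sin)
    fun_prop
  have hi2 : IntervalIntegrable (fun v => cos v * q v) volume 0 π :=
    Continuous.intervalIntegrable (by fun_prop) _ _
  have key := intervalIntegral.integral_eq_sub_of_hasDerivAt_of_le (a := 0) (b := π)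
    (f := fun v => log (sin v) * sin (2 * l * v))
    (f' := fun v => 2 * l * (log (sin v) * cos (2 * l * v)) + cos v * q v) pi_pos.le
    (by
      simp_rw [hF]
      have : Continuous fun v : ℝ => sin v * log (sin v) :=
        Real.continuous_mul_log.comp continuous_sin
      fun_prop)
    (by
      intro v hv
      have hs : sin v ≠ 0 := (sin_pos_of_pos_of_lt_pi hv.1 hv.2).ne'
      have h1 := (Real.hasDerivAt_sin v).log hs
      have h2 : HasDerivAt (fun v : ℝ => sin (2 * l * v)) (cos (2 * l * v) * (2 * l * 1)) v :=
        ((hasDerivAt_id v).const_mul (2 * (l:ℝ))).sin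
      refine (h1.mul h2).congr_deriv ?_
      have h3 : sin (2 * l * v) = sin v * q v := sin_even l v
      rw [h3]
      clear_value q
      field_simp
      ring)
    (hi1.add hi2)
  rw [intervalIntegral.integral_add hi1 hi2, intervalIntegral.integral_const_mul,
    int_dir l hl] at key
  simp at key
  field_simp
  linarith

lemma int_log_sin_sin (l : ℕ) :
    ∫ v in (0:ℝ)..π, log (sin v) * sin (2 * l * v) = 0 := by
  have h := intervalIntegral.integral_comp_sub_left (a := 0) (b := π)
    (fun v => log (sin v) * sin (2 * l * v)) π
  have h2 : ∀ v : ℝ, log (sin (π - v)) * sin (2 * l * (π - v))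
      = -(log (sin v) * sin (2 * l * v)) := by
    intro v
    rw [sin_pi_sub, show 2 * (l:ℝ) * (π - v) = l * (2 * π) - 2 * l * v by ring,
      sin_nat_mul_two_pi_sub]
    ring
  simp_rw [h2] at h
  rw [intervalIntegral.integral_neg] at h
  simp at h
  linarith

/-- the constants -/
noncomputable def C (l : ℕ) : ℝ := ∫ v in (0:ℝ)..π, log (sin v) * cos (2 * l * v)

lemma int_shift (l : ℕ) (φ : ℝ) :
    ∫ θ in (-π)..π, log (sin (θ / 2 + -(φ / 2))) * cos (l * θ) = 2 * C l * cos (l * φ) := by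
  have hper : Function.Periodic (fun θ : ℝ => log (sin (θ / 2 + -(φ / 2))) * cos (l * θ))
      (2 * π) := by
    intro θ
    simp only
    rw [show (θ + 2 * π) / 2 + -(φ / 2) = θ / 2 + -(φ / 2) + π by ring, sin_add_pi, log_neg_eq_log,
      mul_add, cos_add_nat_mul_two_pi]
  have h1 := hper.intervalIntegral_add_eq (-π) φ
  rw [show -π + 2 * π = π by ring] at h1
  rw [h1]
  have h2 := intervalIntegral.integral_comp_mul_add (a := 0) (b := π)
    (fun θ : ℝ => log (sin (θ / 2 + -(φ / 2))) * cos (l * θ)) (two_ne_zero) φ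
  rw [show 2 * 0 + φ = φ by ring, show 2 * π + φ = φ + 2 * π by ring] at h2
  have h3 : ∀ v : ℝ, log (sin ((2 * v + φ) / 2 + -(φ / 2))) * cos (l * (2 * v + φ))
      = cos (l * φ) * (log (sin v) * cos (2 * l * v))
        - sin (l * φ) * (log (sin v) * sin (2 * l * v)) := by
    intro v
    rw [show (2 * v + φ) / 2 + -(φ / 2) = v by ring,
      show (l:ℝ) * (2 * v + φ) = 2 * l * v + l * φ by ring, cos_add]
    ring
  simp_rw [h3] at h2
  have hi : IntervalIntegrable (fun v : ℝ => log (sin v)) volume 0 π :=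
    intervalIntegrable_log_sin
  rw [intervalIntegral.integral_sub
    ((hi.mul_continuousOn (by fun_prop)).const_mul _)
    ((hi.mul_continuousOn (by fun_prop)).const_mul _),
    intervalIntegral.integral_const_mul, intervalIntegral.integral_const_mul,
    int_log_sin_sin] at h2
  rw [smul_eq_mul] at h2
  unfold C
  linarith

lemma int_inner (l : ℕ) (φ : ℝ) :
    ∫ θ in (0:ℝ)..π, log |cos φ - cos θ| * cos (l * θ)
      = log 2 * (∫ θ in (0:ℝ)..π, cos (l * θ)) + 2 * C l * cos (l * φ) := by
  have e1 : ∫ θ in (0:ℝ)..π, log |cos φ - cos θ| * cos (l * θ) =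
      ∫ θ in (0:ℝ)..π, (log 2 * cos (l * θ) + log (sin (θ / 2 + φ / 2)) * cos (l * θ)
        + log (sin (θ / 2 + -(φ / 2))) * cos (l * θ)) := by
    apply intervalIntegral.integral_congr_codiscreteWithin
    apply Filter.codiscreteWithin_mono (by tauto : Set.uIoc 0 π ⊆ Set.univ)
    have t : ∀ c : ℝ, (fun θ : ℝ => sin (θ / 2 + c)) ⁻¹' {0}ᶜ ∈ Filter.codiscrete ℝ := by
      intro c
      have h : AnalyticOnNhd ℝ (fun x : ℝ => sin (x / 2 + c)) Set.univ := by
        intro x _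
        fun_prop
      apply h.preimage_zero_mem_codiscrete (x := π - 2 * c)
      rw [show (π - 2 * c) / 2 + c = π / 2 by ring]
      simp
    filter_upwards [t (φ / 2), t (-(φ / 2))] with θ h₁ h₂
    simp only [Set.mem_preimage, Set.mem_compl_iff, Set.mem_singleton_iff] at h₁ h₂
    have : cos φ - cos θ = 2 * sin (θ / 2 + φ / 2) * sin (θ / 2 + -(φ / 2)) := by
      rw [cos_sub_cos, show (φ + θ) / 2 = θ / 2 + φ / 2 by ring,
        show (φ - θ) / 2 = -(θ / 2 + -(φ / 2)) by ring, sin_neg]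
      ring
    rw [log_abs, this, log_mul (by simp [h₁]) h₂, log_mul (by simp) h₁]
    ring
  have i0 : IntervalIntegrable (fun θ : ℝ => log 2 * cos (l * θ)) volume 0 π :=
    Continuous.intervalIntegrable (by fun_prop) _ _
  have i1 : ∀ a b c : ℝ, IntervalIntegrable (fun θ : ℝ => log (sin (θ / 2 + c)) * cos (l * θ))
      volume a b := fun a b c => (ii_log a b c).mul_continuousOn (by fun_prop)
  rw [e1, intervalIntegral.integral_add (i0.add (i1 _ _ _)) (i1 _ _ _),
    intervalIntegral.integral_add i0 (i1 _ _ _), intervalIntegral.integral_const_mul,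
    ← int_shift, ← intervalIntegral.integral_add_adjacent_intervals (i1 (-π) 0 _) (i1 0 π _)]
  have e2 := intervalIntegral.integral_comp_neg (a := 0) (b := π)
    (fun θ : ℝ => log (sin (θ / 2 + -(φ / 2))) * cos (l * θ))
  have e3 : ∀ θ : ℝ, log (sin (-θ / 2 + -(φ / 2))) * cos (l * -θ)
      = log (sin (θ / 2 + φ / 2)) * cos (l * θ) := by
    intro θ
    rw [show -θ / 2 + -(φ / 2) = -(θ / 2 + φ / 2) by ring, sin_neg, log_neg_eq_log, mul_neg,
      cos_neg]
  simp_rw [e3] at e2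
  rw [neg_zero] at e2
  rw [e2]
  ring

lemma int_inner' (l : ℕ) (φ : ℝ) :
    ∫ θ in (0:ℝ)..π, log |cos φ - cos θ| * cos (l * θ)
      = (if l = 0 then - π * log 2 else - π / l) * cos (l * φ) := by
  rw [int_inner]
  split_ifs with h
  · subst h
    have : C 0 = -log 2 * π := by simp [C, integral_log_sin_zero_pi]
    rw [this]
    simp
    ring
  · rw [int_cos l h, C, int_log_sin_cos l h]
    have hl' : (l:ℝ) ≠ 0 := by exact_mod_cast h
    field_simp
    ring

lemma to_cos (f : ℝ → ℝ) :
    ∫ x in (-1:ℝ)..1, f x * (1 - x ^ 2) ^ (-(1/2) : ℝ) = ∫ θ in (0:ℝ)..π, f (cos θ) := by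
  rw [← Polynomial.Chebyshev.integral_measureT_eq_integral_cos,
    Polynomial.Chebyshev.integral_measureT]
  refine intervalIntegral.integral_congr fun x hx => ?_
  rw [Set.uIcc_of_le (by norm_num)] at hx
  have : 0 ≤ 1 - x ^ 2 := by nlinarith [hx.1, hx.2]
  rw [rpow_neg this, ← sqrt_eq_rpow]
  simp

end LogCheb

/-- The double logarithmic-kernel integral against weighted first-kind Chebyshev
polynomials. -/
theorem log_kernel_chebyshev_double_integral (l n : ℕ) :
    (∫ s in (-1:ℝ)..1, ∫ t in (-1:ℝ)..1,
      Real.log |s - t| * ((1 - t ^ 2) ^ (-(1/2) : ℝ) * (Polynomial.Chebyshev.T ℝ l).eval t) *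
        ((1 - s ^ 2) ^ (-(1/2) : ℝ) * (Polynomial.Chebyshev.T ℝ n).eval s)) =
      if l = n then (if n = 0 then -Real.pi ^ 2 * Real.log 2 else -Real.pi ^ 2 / (2 * n))
      else 0 := by
  have h1 : ∀ s : ℝ, (∫ t in (-1:ℝ)..1,
      Real.log |s - t| * ((1 - t ^ 2) ^ (-(1/2) : ℝ) * (Polynomial.Chebyshev.T ℝ l).eval t) *
        ((1 - s ^ 2) ^ (-(1/2) : ℝ) * (Polynomial.Chebyshev.T ℝ n).eval s))
      = ((∫ θ in (0:ℝ)..Real.pi, Real.log |s - Real.cos θ| * Real.cos (l * θ)) *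
        (Polynomial.Chebyshev.T ℝ n).eval s) * (1 - s ^ 2) ^ (-(1/2) : ℝ) := by
    intro s
    rw [intervalIntegral.integral_mul_const]
    have := LogCheb.to_cos (fun t => Real.log |s - t| * (Polynomial.Chebyshev.T ℝ l).eval t)
    simp only [Polynomial.Chebyshev.T_real_cos, Int.cast_natCast] at this
    rw [← this]
    have e : (∫ t in (-1:ℝ)..1, Real.log |s - t| *
        ((1 - t ^ 2) ^ (-(1/2) : ℝ) * (Polynomial.Chebyshev.T ℝ l).eval t)) =
        ∫ t in (-1:ℝ)..1, Real.log |s - t| * (Polynomial.Chebyshev.T ℝ l).eval t *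
          (1 - t ^ 2) ^ (-(1/2) : ℝ) := by
      congr 1
      funext t
      ring
    rw [e]
    ring
  simp_rw [h1]
  rw [LogCheb.to_cos (fun s => (∫ θ in (0:ℝ)..Real.pi, Real.log |s - Real.cos θ| *
    Real.cos (l * θ)) * (Polynomial.Chebyshev.T ℝ n).eval s)]
  simp_rw [LogCheb.int_inner', mul_assoc]
  rw [intervalIntegral.integral_const_mul]
  have h2 : (∫ x in (0:ℝ)..Real.pi, Real.cos (l * x) *
      (Polynomial.Chebyshev.T ℝ n).eval (Real.cos x)) =
      ∫ x, (Polynomial.Chebyshev.T ℝ l).eval x * (Polynomial.Chebyshev.T ℝ n).eval x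
        ∂Polynomial.Chebyshev.measureT := by
    rw [Polynomial.Chebyshev.integral_measureT_eq_integral_cos]
    simp only [Polynomial.Chebyshev.T_real_cos, Int.cast_natCast]
  rw [h2]
  by_cases hln : l = n
  · subst hln
    by_cases hl : l = 0
    · subst hl
      have := Polynomial.Chebyshev.integral_eval_T_real_mul_self_measureT_zero
      simp only [Nat.cast_zero, this, if_true]
      ring
    · rw [Polynomial.Chebyshev.integral_T_real_mul_self_measureT_of_ne_zero hl]
      have hl' : (l:ℝ) ≠ 0 := by exact_mod_cast hl
      simp only [hl, if_true, if_false]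
      field_simp
  · rw [Polynomial.Chebyshev.integral_eval_T_real_mul_eval_T_real_measureT_of_ne hln]
    simp [hln]
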